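/- Let R : {1, 2, 3, …} → ℝ satisfy 0 ≤ R(γ) ≤ 2/21 for all γ ≥ 1. Let Γ_1, Γ_2 be i.i.d. random variables on ℕ with Pr[Γ = 2] = 2/3 and Pr[Γ = γ + 2] = (6/7)·4^{-γ} + R(γ)·2^{-γ} for every integer γ ≥ 1 (assume these values sum to 1), and let s_1, s_2 be i.i.d. random variables on ℕ with Pr[s_i = k] = 2^{-(k+1)}, independent of Γ_1, Γ_2. Then the probability P that the intervals [s_1, s_1 + Γ_1] and [s_2, s_2 + Γ_2] are disjoint satisfies 58/441 < P < 58/441 + 1/189; in particular 0.1315 < P < 0.1369. -/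

import Mathlib

open scoped Classical

/-- The Total Store Order critical-window-length distribution with remainder
term `R`: `Pr[Γ = 2] = 2/3` and
`Pr[Γ = γ + 2] = (6/7)·4^{-γ} + R(γ)·2^{-γ}` for every integer `γ ≥ 1`
(window length = gap + 2). -/
noncomputable def tsoPMF (R : ℕ → ℝ) (g : ℕ) : ℝ :=
  if g = 2 then 2 / 3
  else if 3 ≤ g then (6 / 7) * (4:ℝ)⁻¹ ^ (g - 2) + R (g - 2) * (2:ℝ)⁻¹ ^ (g - 2)
  else 0

/-- The probability, for `Γ₁, Γ₂` i.i.d. with distribution `tsoPMF R` and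
`s₁, s₂` i.i.d. with `Pr[sᵢ = k] = 2^{-(k+1)}` independent of `Γ₁, Γ₂`, that
the random intervals `[s₁, s₁ + Γ₁]` and `[s₂, s₂ + Γ₂]` are disjoint. -/
noncomputable def tsoDisjointProb (R : ℕ → ℝ) : ℝ :=
  ∑' x : (ℕ × ℕ) × ℕ × ℕ,
    if Disjoint (Finset.Icc x.2.1 (x.2.1 + x.1.1))
        (Finset.Icc x.2.2 (x.2.2 + x.1.2)) then
      tsoPMF R x.1.1 * tsoPMF R x.1.2 * (2:ℝ)⁻¹ ^ (x.2.1 + 1) * (2:ℝ)⁻¹ ^ (x.2.2 + 1)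
    else 0

lemma HasSum.of_eq {f g : ℕ → ℝ} {a b : ℝ} (h : HasSum f a) (hfg : ∀ n, g n = f n)
    (hab : b = a) : HasSum g b := by
  rwa [funext hfg, hab]
/-- A geometric(1/2) variable exceeds `m` with probability `2^{-(m+1)}`. -/
lemma hasSum_geometric_tail (m : ℕ) :
    HasSum (fun t : ℕ => if m < t then (2:ℝ)⁻¹ ^ (t + 1) else 0) ((2:ℝ)⁻¹ ^ (m + 1)) := by
  rw [← hasSum_nat_add_iff' (m + 1)]
  have h0 : ∑ i ∈ Finset.range (m + 1), (if m < i then (2:ℝ)⁻¹ ^ (i + 1) else 0) = 0 :=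
    Finset.sum_eq_zero fun i hi => if_neg (by have := Finset.mem_range.mp hi; omega)
  rw [h0, sub_zero]
  refine HasSum.of_eq ((hasSum_geometric_of_lt_one (r := (2:ℝ)⁻¹) (by norm_num) (by norm_num)).mul_left
    ((2:ℝ)⁻¹ ^ (m + 2))) (fun n => ?_) ?_
  · rw [if_pos (show m < n + (m + 1) by omega)]
    ring
  · norm_num
    ring

lemma summable_geometric_half_succ : Summable fun t : ℕ => (2:ℝ)⁻¹ ^ (t + 1) :=
  (summable_nat_add_iff 1).mpr (summable_geometric_of_lt_one (by norm_num) (by norm_num))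

lemma summable_geometric_half_prod :
    Summable fun s : ℕ × ℕ => (2:ℝ)⁻¹ ^ (s.1 + 1) * (2:ℝ)⁻¹ ^ (s.2 + 1) :=
  summable_geometric_half_succ.mul_of_nonneg summable_geometric_half_succ
    (fun _ => by positivity) (fun _ => by positivity)

/-- For i.i.d. geometric(1/2) variables, `s₂` exceeds `s₁ + g` with probability `2^{-g} / 3`. -/
lemma tsum_geometric_gap (g : ℕ) :
    ∑' s : ℕ × ℕ, (if s.1 + g < s.2 then (2:ℝ)⁻¹ ^ (s.1 + 1) * (2:ℝ)⁻¹ ^ (s.2 + 1) else 0)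
      = (2:ℝ)⁻¹ ^ g / 3 := by
  have hs : Summable fun s : ℕ × ℕ =>
      (if s.1 + g < s.2 then (2:ℝ)⁻¹ ^ (s.1 + 1) * (2:ℝ)⁻¹ ^ (s.2 + 1) else 0) :=
    Summable.of_nonneg_of_le (fun s => by split_ifs <;> positivity)
      (fun s => by split_ifs; exacts [le_rfl, by positivity]) summable_geometric_half_prod
  rw [hs.tsum_prod]
  have inner (a : ℕ) :
      ∑' b : ℕ, (if a + g < b then (2:ℝ)⁻¹ ^ (a + 1) * (2:ℝ)⁻¹ ^ (b + 1) else 0)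
        = (2:ℝ)⁻¹ ^ (g + 2) * (4:ℝ)⁻¹ ^ a := by
    simp_rw [← mul_ite_zero, tsum_mul_left, (hasSum_geometric_tail (a + g)).tsum_eq]
    rw [show (4:ℝ)⁻¹ = 2⁻¹ * 2⁻¹ by norm_num, mul_pow]
    ring
  simp_rw [inner, tsum_mul_left]
  rw [tsum_geometric_of_lt_one (by norm_num) (by norm_num)]
  norm_num
  ring

lemma disjoint_Icc_add_iff (a b g h : ℕ) :
    Disjoint (Finset.Icc a (a + g)) (Finset.Icc b (b + h)) ↔ a + g < b ∨ b + h < a := by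
  rw [Finset.disjoint_left]
  simp only [Finset.mem_Icc]
  constructor
  · intro H
    by_contra! hc
    rcases le_total a b with hab | hab
    · exact H (a := b) (by omega) (by omega)
    · exact H (a := a) (by omega) (by omega)
  · intro H x
    omega

/-- For i.i.d. geometric(1/2) shifts, segments of lengths `g` and `h` are disjoint with probability
`(2^{-g} + 2^{-h}) / 3`. -/
lemma tsum_disjoint_shift (g h : ℕ) :
    ∑' s : ℕ × ℕ, (if Disjoint (Finset.Icc s.1 (s.1 + g)) (Finset.Icc s.2 (s.2 + h)) then
      (2:ℝ)⁻¹ ^ (s.1 + 1) * (2:ℝ)⁻¹ ^ (s.2 + 1) else 0) = ((2:ℝ)⁻¹ ^ g + (2:ℝ)⁻¹ ^ h) / 3 := by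
  have split (s : ℕ × ℕ) :
      (if Disjoint (Finset.Icc s.1 (s.1 + g)) (Finset.Icc s.2 (s.2 + h)) then
        (2:ℝ)⁻¹ ^ (s.1 + 1) * (2:ℝ)⁻¹ ^ (s.2 + 1) else 0)
      = (if s.1 + g < s.2 then (2:ℝ)⁻¹ ^ (s.1 + 1) * (2:ℝ)⁻¹ ^ (s.2 + 1) else 0)
        + (if s.2 + h < s.1 then (2:ℝ)⁻¹ ^ (s.1 + 1) * (2:ℝ)⁻¹ ^ (s.2 + 1) else 0) := by
    simp only [disjoint_Icc_add_iff]
    by_cases h1 : s.1 + g < s.2 <;> by_cases h2 : s.2 + h < s.1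
    · omega
    all_goals simp [h1, h2]
  have hsum (p : ℕ × ℕ → Prop) : Summable fun s : ℕ × ℕ =>
      (if p s then (2:ℝ)⁻¹ ^ (s.1 + 1) * (2:ℝ)⁻¹ ^ (s.2 + 1) else 0) :=
    Summable.of_nonneg_of_le (fun s => by split_ifs <;> positivity)
      (fun s => by split_ifs; exacts [le_rfl, by positivity]) summable_geometric_half_prod
  have swap : ∑' s : ℕ × ℕ,
      (if s.2 + h < s.1 then (2:ℝ)⁻¹ ^ (s.1 + 1) * (2:ℝ)⁻¹ ^ (s.2 + 1) else 0)
        = (2:ℝ)⁻¹ ^ h / 3 := by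
    rw [← tsum_geometric_gap h, ← (Equiv.prodComm ℕ ℕ).tsum_eq]
    exact tsum_congr fun s => by simp [mul_comm]
  have h1 := hsum fun s => s.1 + g < s.2
  have h2 := hsum fun s => s.2 + h < s.1
  rw [tsum_congr split, Summable.tsum_add (by convert h1) (by convert h2), swap,
    tsum_geometric_gap]
  ring

lemma tsoPMF_add_three (R : ℕ → ℝ) (n : ℕ) :
    tsoPMF R (n + 3) = (6 / 7) * (4:ℝ)⁻¹ ^ (n + 1) + R (n + 1) * (2:ℝ)⁻¹ ^ (n + 1) := by
  simp [tsoPMF]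

/-- Normalisation of `tsoPMF R` fixes the total weight of the remainder term. -/
lemma hasSum_remainder (R : ℕ → ℝ) (hs : HasSum (tsoPMF R) 1) :
    HasSum (fun n => R (n + 1) * (2:ℝ)⁻¹ ^ (n + 1)) (1 / 21) := by
  have h1 := (hasSum_nat_add_iff' 3).mpr hs
  have h2 := (hasSum_geometric_of_lt_one (r := (4:ℝ)⁻¹) (by norm_num) (by norm_num)).mul_left
    ((6 / 7) * (4:ℝ)⁻¹)
  refine HasSum.of_eq (h1.sub h2) (fun n => ?_) ?_
  · rw [tsoPMF_add_three]
    ring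
  · norm_num [Finset.sum_range_succ, tsoPMF]

/-- The disjointness probability equals `(2/3) E[2^{-Γ}]`. -/
lemma tsoDisjointProb_eq (R : ℕ → ℝ) (hs : HasSum (tsoPMF R) 1) (h0 : ∀ g, 0 ≤ tsoPMF R g) :
    tsoDisjointProb R = (2 / 3) * ∑' g, tsoPMF R g * (2:ℝ)⁻¹ ^ g := by
  have hp : Summable fun x : ℕ × ℕ => tsoPMF R x.1 * tsoPMF R x.2 :=
    hs.summable.mul_of_nonneg hs.summable h0 h0
  have hbase : Summable fun x : (ℕ × ℕ) × ℕ × ℕ => (tsoPMF R x.1.1 * tsoPMF R x.1.2) *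
      ((2:ℝ)⁻¹ ^ (x.2.1 + 1) * (2:ℝ)⁻¹ ^ (x.2.2 + 1)) :=
    hp.mul_of_nonneg summable_geometric_half_prod (fun x => mul_nonneg (h0 _) (h0 _))
      (fun _ => by positivity)
  have hall : Summable fun x : (ℕ × ℕ) × ℕ × ℕ =>
      if Disjoint (Finset.Icc x.2.1 (x.2.1 + x.1.1)) (Finset.Icc x.2.2 (x.2.2 + x.1.2)) then
        tsoPMF R x.1.1 * tsoPMF R x.1.2 * (2:ℝ)⁻¹ ^ (x.2.1 + 1) * (2:ℝ)⁻¹ ^ (x.2.2 + 1)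
      else 0 := by
    refine Summable.of_nonneg_of_le (fun x => ?_) (fun x => ?_) hbase
    all_goals
      have := mul_nonneg (h0 x.1.1) (h0 x.1.2)
      split_ifs
    · positivity
    · exact le_rfl
    · exact (mul_assoc _ _ _).le
    · positivity
  have hm : Summable fun g => tsoPMF R g * (2:ℝ)⁻¹ ^ g :=
    Summable.of_nonneg_of_le (fun g => mul_nonneg (h0 g) (by positivity))
      (fun g => mul_le_of_le_one_right (h0 g) (pow_le_one₀ (by norm_num) (by norm_num))) hs.summable
  have hm0 (g : ℕ) : 0 ≤ tsoPMF R g * (2:ℝ)⁻¹ ^ g := mul_nonneg (h0 g) (by positivity)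
  rw [tsoDisjointProb, hall.tsum_prod]
  have inner (x : ℕ × ℕ) : ∑' s : ℕ × ℕ,
      (if Disjoint (Finset.Icc s.1 (s.1 + x.1)) (Finset.Icc s.2 (s.2 + x.2)) then
        tsoPMF R x.1 * tsoPMF R x.2 * (2:ℝ)⁻¹ ^ (s.1 + 1) * (2:ℝ)⁻¹ ^ (s.2 + 1) else 0)
      = (1 / 3) * ((tsoPMF R x.1 * (2:ℝ)⁻¹ ^ x.1) * tsoPMF R x.2
        + tsoPMF R x.1 * (tsoPMF R x.2 * (2:ℝ)⁻¹ ^ x.2)) := by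
    simp_rw [mul_assoc (tsoPMF R x.1 * tsoPMF R x.2),
      ← mul_ite_zero _ (tsoPMF R x.1 * tsoPMF R x.2), tsum_mul_left]
    rw [tsum_disjoint_shift]
    ring
  rw [tsum_congr inner, tsum_mul_left,
    Summable.tsum_add (hm.mul_of_nonneg hs.summable hm0 h0)
      (hs.summable.mul_of_nonneg hm h0 hm0),
    ← hm.tsum_mul_tsum hs.summable (hm.mul_of_nonneg hs.summable hm0 h0),
    ← hs.summable.tsum_mul_tsum hm (hs.summable.mul_of_nonneg hm h0 hm0), hs.tsum_eq]
  ring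

/-- Let `R` satisfy `0 ≤ R(γ) ≤ 2/21` for all `γ ≥ 1`, and assume the values
of `tsoPMF R` sum to 1.  Then the probability `P` that the two shifted
TSO critical windows are disjoint satisfies
`58/441 < P < 58/441 + 1/189`; in particular `0.1315 < P < 0.1369`. -/
theorem tso_two_threads_prob (R : ℕ → ℝ)
    (hR : ∀ γ : ℕ, 1 ≤ γ → 0 ≤ R γ ∧ R γ ≤ 2 / 21)
    (hsum : ∑' g : ℕ, tsoPMF R g = 1) :
    (58 / 441 < tsoDisjointProb R ∧ tsoDisjointProb R < 58 / 441 + 1 / 189) ∧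
      (0.1315 < tsoDisjointProb R ∧ tsoDisjointProb R < 0.1369) := by
  have hs : HasSum (tsoPMF R) 1 := by
    have : Summable (tsoPMF R) := by
      by_contra h
      simp [tsum_eq_zero_of_not_summable h] at hsum
    exact hsum ▸ this.hasSum
  have h0 (g : ℕ) : 0 ≤ tsoPMF R g := by
    unfold tsoPMF
    split_ifs with _ h3
    · norm_num
    · have := (hR (g - 2) (by omega)).1
      positivity
    · exact le_rfl
  have hR0 (n : ℕ) := (hR (n + 1) (by omega)).1
  have hR1 (n : ℕ) := (hR (n + 1) (by omega)).2
  have hr := hasSum_remainder R hs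
  have g4 : HasSum (fun n : ℕ => (4:ℝ)⁻¹ ^ (n + 1)) (1 / 3) := by
    refine HasSum.of_eq ((hasSum_geometric_of_lt_one (r := (4:ℝ)⁻¹) (by norm_num) (by norm_num)).mul_left
      ((4:ℝ)⁻¹)) (fun n => ?_) ?_
    · ring
    · norm_num
  have g2 : HasSum (fun n : ℕ => (2:ℝ)⁻¹ ^ (n + 1)) 1 := by
    refine HasSum.of_eq ((hasSum_geometric_of_lt_one (r := (2:ℝ)⁻¹) (by norm_num) (by norm_num)).mul_left
      ((2:ℝ)⁻¹)) (fun n => ?_) ?_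
    · ring
    · norm_num
  have hS : Summable fun n => R (n + 1) * (4:ℝ)⁻¹ ^ (n + 1) :=
    Summable.of_nonneg_of_le (fun n => mul_nonneg (hR0 n) (by positivity))
      (fun n => mul_le_mul_of_nonneg_right (hR1 n) (by positivity)) (g4.summable.mul_left (2 / 21))
  have hSpos : 0 < ∑' n, R (n + 1) * (4:ℝ)⁻¹ ^ (n + 1) := by
    obtain ⟨n, hn⟩ : ∃ n, R (n + 1) ≠ 0 := by
      by_contra! h
      have := hr.tsum_eq
      simp [h] at this
    exact hS.tsum_pos (fun n => mul_nonneg (hR0 n) (by positivity)) n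
      (mul_pos ((hR0 n).lt_of_ne hn.symm) (by positivity))
  have hSlt : ∑' n, R (n + 1) * (4:ℝ)⁻¹ ^ (n + 1) < 2 / 63 := by
    obtain ⟨n, hn⟩ : ∃ n, R (n + 1) ≠ 2 / 21 := by
      by_contra! h
      simp only [h] at hr
      have := hr.unique (g2.mul_left (2 / 21))
      norm_num at this
    have := Summable.tsum_lt_tsum (i := n)
      (fun k => mul_le_mul_of_nonneg_right (hR1 k) (by positivity))
      (mul_lt_mul_of_pos_right ((hR1 n).lt_of_ne hn) (by positivity))
      hS (g4.summable.mul_left (2 / 21))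
    rw [(g4.mul_left (2 / 21)).tsum_eq] at this
    linarith
  have hE : HasSum (fun g => tsoPMF R g * (2:ℝ)⁻¹ ^ g)
      (1 / 6 + 3 / 98 + (1 / 4) * ∑' n, R (n + 1) * (4:ℝ)⁻¹ ^ (n + 1)) := by
    rw [← hasSum_nat_add_iff' 3]
    have g8 := (hasSum_geometric_of_lt_one (r := (8:ℝ)⁻¹) (by norm_num) (by norm_num)).mul_left
      (3 / 112)
    refine HasSum.of_eq (g8.add (hS.hasSum.mul_left (1 / 4))) (fun n => ?_) ?_
    · rw [tsoPMF_add_three, show (8:ℝ)⁻¹ = 4⁻¹ * 2⁻¹ by norm_num,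
        show (4:ℝ)⁻¹ = 2⁻¹ * 2⁻¹ by norm_num]
      simp only [mul_pow]
      ring
    · norm_num [Finset.sum_range_succ, tsoPMF]
      ring
  have hP := tsoDisjointProb_eq R hs h0
  rw [hE.tsum_eq] at hP
  refine ⟨⟨?_, ?_⟩, ?_, ?_⟩ <;> norm_num <;> linarith
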